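/- For every j ≥ 1 with k = k(j), the value F(j + 1/2) equals (2^{2^k − 1} + 1)/2^{2^k}, whose numerator is odd, so written in lowest terms the denominator of the rational number F(j + 1/2) equals 2^{2^k}; moreover 2^k ≥ j + 1, and hence this denominator is at least 2^{j+1}. -/

import Mathlib

/-- A real number is a dyadic rational if it has the form `m / 2^n`. -/
def IsDyadic (x : ℝ) : Prop := ∃ (m : ℤ) (n : ℕ), x = (m : ℝ) / 2 ^ n

/-- Affine interpolation on `[a,b]` with values `fa` at `a` and `fb` at `b`. -/
noncomputable def interp (a b fa fb x : ℝ) : ℝ := fa + (x - a) * (fb - fa) / (b - a)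

/-- `kmin j = min { i : j + 1/2 < 2^i }`. -/
noncomputable def kmin (j : ℕ) : ℕ := sInf {i : ℕ | (j : ℝ) + 1 / 2 < 2 ^ i}

/-- The specification of the function `F` of the paper: `F(j) = 0` for every `j ∈ ℕ`,
`F(j + 1/2) = 1/2 + 2^{-2^{k(j)}}`, and `F` is affine on each of `[j, j + 1/2]` and
`[j + 1/2, j + 1]`. -/
def SpecFF (F : ℝ → ℝ) : Prop :=
  (∀ j : ℕ, F (j : ℝ) = 0) ∧
  (∀ j : ℕ, F ((j : ℝ) + 1 / 2) = 1 / 2 + (2 : ℝ) ^ (-(2 ^ kmin j : ℤ))) ∧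
  (∀ j : ℕ, ∀ x ∈ Set.Icc (j : ℝ) ((j : ℝ) + 1 / 2),
    F x = interp (j : ℝ) ((j : ℝ) + 1 / 2) (F (j : ℝ)) (F ((j : ℝ) + 1 / 2)) x) ∧
  (∀ j : ℕ, ∀ x ∈ Set.Icc ((j : ℝ) + 1 / 2) ((j : ℝ) + 1),
    F x = interp ((j : ℝ) + 1 / 2) ((j : ℝ) + 1) (F ((j : ℝ) + 1 / 2)) (F ((j : ℝ) + 1)) x)

/-- for every `j ≥ 1` with `k = kmin j`, the value `F(j + 1/2)` equals
`(2^(2^k − 1) + 1)/2^(2^k)`, whose numerator is odd, so in lowest terms the denominator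
of the rational number `F(j + 1/2)` is `2^(2^k)`; moreover `2^k ≥ j + 1`, hence this
denominator is at least `2^(j+1)`. -/
theorem statement12 (F : ℝ → ℝ) (hF : SpecFF F) :
    ∀ j : ℕ, 1 ≤ j →
      F ((j : ℝ) + 1 / 2) =
        ((2 ^ (2 ^ kmin j - 1) + 1 : ℕ) : ℝ) / 2 ^ 2 ^ kmin j ∧
      Odd (2 ^ (2 ^ kmin j - 1) + 1 : ℕ) ∧
      (((2 ^ (2 ^ kmin j - 1) + 1 : ℕ) : ℚ) / 2 ^ 2 ^ kmin j).den = 2 ^ 2 ^ kmin j ∧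
      j + 1 ≤ 2 ^ kmin j ∧
      2 ^ (j + 1) ≤ (((2 ^ (2 ^ kmin j - 1) + 1 : ℕ) : ℚ) / 2 ^ 2 ^ kmin j).den := by
  intro j hj
  have hne : {i : ℕ | (j : ℝ) + 1 / 2 < 2 ^ i}.Nonempty := by
    obtain ⟨n, hn⟩ := pow_unbounded_of_one_lt ((j : ℝ) + 1 / 2) (one_lt_two)
    exact ⟨n, hn⟩
  have hk : (j : ℝ) + 1 / 2 < 2 ^ kmin j := Nat.sInf_mem hne
  have hjk : j + 1 ≤ 2 ^ kmin j := by
    have h : (j : ℝ) < ((2 ^ kmin j : ℕ) : ℝ) := by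
      push_cast
      linarith
    exact_mod_cast h
  have hv := hF.2.1 j
  have hz : (2 : ℝ) ^ (-(2 ^ kmin j : ℤ)) = ((2 : ℝ) ^ (2 ^ kmin j : ℕ))⁻¹ := by
    rw [zpow_neg, ← zpow_natCast]
    push_cast
    rfl
  rw [hz] at hv
  generalize 2 ^ kmin j = N at *
  obtain ⟨m, rfl⟩ : ∃ m, N = m + 2 := ⟨N - 2, by omega⟩
  have hodd : Odd (2 ^ (m + 2 - 1) + 1 : ℕ) := by
    have : m + 2 - 1 = m + 1 := rfl
    rw [this, pow_succ]
    exact ⟨2 ^ m, by ring⟩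
  have hden : (((2 ^ (m + 2 - 1) + 1 : ℕ) : ℚ) / 2 ^ (m + 2)).den = 2 ^ (m + 2) := by
    have hc : Nat.Coprime (2 ^ (m + 2 - 1) + 1) (2 ^ (m + 2)) :=
      (Nat.coprime_two_right.mpr hodd).pow_right _
    have h := Rat.den_div_eq_of_coprime (a := ((2 ^ (m + 2 - 1) + 1 : ℕ) : ℤ))
      (b := ((2 ^ (m + 2) : ℕ) : ℤ)) (by positivity) (by simpa only [Int.natAbs_natCast] using hc)
    have h2 : (((2 ^ (m + 2) : ℕ) : ℤ) : ℚ) = 2 ^ (m + 2) := by push_cast; rfl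
    rw [h2, Int.cast_natCast] at h
    exact_mod_cast h
  refine ⟨?_, hodd, hden, hjk, ?_⟩
  · rw [hv]
    have : m + 2 - 1 = m + 1 := rfl
    rw [this]
    push_cast
    field_simp
    ring
  · rw [hden]
    exact Nat.pow_le_pow_right (by norm_num) hjk
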